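/- arXiv:2203.05301 — 2 statements merged into one kernel-verified Lean document; each statement's English description precedes it below -/
import Mathlib

section
/- Let F be a finite field with |F| = q and λ ∈ F^×. For every real δ ∈ (0, 1 − 1/q) with h_q(δ) < 1/2, there exist positive integers m_1, m_2, … tending to infinity and quasi-constacyclic codes C_i of index 2 and co-index m_i over F such that Δ(C_i) > δ for all i and lim_{i→∞} R(C_i) = 1/2. In particular, quasi-constacyclic codes of index 2 over any finite field are asymptotically good. -/
open Polynomial

/-- The canonical representative (of degree `< deg g` when `g` is monic) of a class in
`F[X]/⟨g⟩`. -/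
noncomputable def polyRep {R : Type*} [CommRing R] (g : Polynomial R)
    (c : Polynomial R ⧸ Ideal.span {g}) : Polynomial R :=
  Function.surjInv Ideal.Quotient.mk_surjective c %ₘ g

/-- The Hamming weight of a class in `F[X]/⟨g⟩`: the number of nonzero coefficients of its
canonical representative of degree `< deg g` (`g` monic). -/
noncomputable def qwt {R : Type*} [CommRing R] (g : Polynomial R)
    (c : Polynomial R ⧸ Ideal.span {g}) : ℕ :=
  (polyRep g c).support.card

/-- The `q`-ary entropy function `h_q`. -/
noncomputable def entropy (q : ℕ) (x : ℝ) : ℝ :=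
  x * Real.logb q (q - 1) - x * Real.logb q x - (1 - x) * Real.logb q (1 - x)

/-- The quotient ring `F[X]/⟨X^N − c⟩`. -/
abbrev QA (F : Type*) [CommRing F] (N : ℕ) (c : F) : Type _ :=
  Polynomial F ⧸ Ideal.span {(X : Polynomial F) ^ N - C c}

/-- Volume bound for Hamming balls: at most `q ^ (n h_q(δ))` vectors of length `n` have weight
at most `δ n`. -/
theorem card_hammingNorm_le {F : Type*} [Field F] [Fintype F] [DecidableEq F]
    {ι : Type*} [Fintype ι] [DecidableEq ι] {δ : ℝ} (hδ0 : 0 < δ)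
    (hδ1 : δ < 1 - 1 / (Fintype.card F : ℝ)) :
    ((Finset.univ.filter fun y : ι → F =>
        (hammingNorm y : ℝ) ≤ δ * Fintype.card ι).card : ℝ) ≤
      (Fintype.card F : ℝ) ^ ((Fintype.card ι : ℝ) * entropy (Fintype.card F) δ) := by
  set q := Fintype.card F with hq
  have hq1 : (1 : ℝ) < q := by exact_mod_cast Fintype.one_lt_card
  have hq0 : (0 : ℝ) < q := by linarith
  have hq1' : (0 : ℝ) < q - 1 := by linarith
  have hδ2 : 0 < 1 - δ := by
    have : 0 < 1 / (q : ℝ) := by positivity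
    linarith
  let w : F → ℝ := fun x => if x = 0 then 1 - δ else δ / (q - 1)
  have hsum : ∑ x, w x = 1 := by
    rw [Fintype.sum_eq_add_sum_compl 0]
    have : ∑ x ∈ ({0} : Finset F)ᶜ, w x = ∑ x ∈ ({0} : Finset F)ᶜ, δ / ((q : ℝ) - 1) := by
      refine Finset.sum_congr rfl fun x hx => ?_
      have : x ≠ 0 := by simpa using hx
      simp [w, this]
    rw [this, Finset.sum_const, Finset.card_compl, Finset.card_singleton, nsmul_eq_mul,
      Nat.cast_sub Fintype.card_pos, ← hq]
    simp only [w, if_true, Nat.cast_one]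
    field_simp
    ring
  have htot : ∑ y : ι → F, ∏ i, w (y i) = 1 := by
    have := Finset.prod_univ_sum (fun _ : ι => (Finset.univ : Finset F)) (fun _ x => w x)
    rw [Fintype.piFinset_univ] at this
    rw [← this]
    simp [hsum]
  have hw : ∀ y : ι → F, 0 ≤ ∏ i, w (y i) := fun y => Finset.prod_nonneg fun i _ => by
    simp only [w]
    split_ifs
    · exact hδ2.le
    · positivity
  set n := Fintype.card ι
  set B := (q : ℝ) ^ ((n : ℝ) * entropy q δ) with hB
  have hBpos : 0 < B := Real.rpow_pos_of_pos hq0 _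
  have hlow : ∀ y : ι → F, (hammingNorm y : ℝ) ≤ δ * n → B⁻¹ ≤ ∏ i, w (y i) := by
    intro y hy
    have hle : hammingNorm y ≤ n := hammingNorm_le_card_fintype
    have hprod : ∏ i, w (y i) = (1 - δ) ^ (n - hammingNorm y) * (δ / (q - 1)) ^ hammingNorm y := by
      simp only [w]
      rw [Finset.prod_ite, Finset.prod_const, Finset.prod_const, hammingNorm]
      congr 2
      have := Finset.card_filter_add_card_filter_not (s := Finset.univ) (fun i => y i = 0)
      rw [Finset.card_univ] at this
      change _ = n at this
      simp only [ne_eq]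
      omega
    have hpos : 0 < ∏ i, w (y i) := by rw [hprod]; positivity
    rw [← Real.log_le_log_iff (inv_pos.2 hBpos) hpos, Real.log_inv, hprod,
      Real.log_mul (by positivity) (by positivity), Real.log_pow, Real.log_pow, hB,
      Real.log_rpow hq0, Real.log_div hδ0.ne' hq1'.ne', Nat.cast_sub hle]
    have hlogq : Real.log q ≠ 0 := (Real.log_pos hq1).ne'
    have hent : entropy q δ * Real.log q =
        δ * Real.log (q - 1) - δ * Real.log δ - (1 - δ) * Real.log (1 - δ) := by
      simp only [entropy, Real.logb]
      field_simp
    have hkey : Real.log δ ≤ Real.log (1 - δ) + Real.log (q - 1) := by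
      rw [← Real.log_mul hδ2.ne' hq1'.ne']
      refine Real.log_le_log hδ0 ?_
      have : δ * q < (1 - 1 / (q : ℝ)) * q := mul_lt_mul_of_pos_right hδ1 hq0
      field_simp at this
      nlinarith
    have : (n : ℝ) * entropy q δ * Real.log q =
        n * (δ * Real.log (q - 1) - δ * Real.log δ - (1 - δ) * Real.log (1 - δ)) := by
      rw [mul_assoc, hent]
    rw [this]
    nlinarith [mul_nonneg (sub_nonneg.2 hy) (sub_nonneg.2 hkey)]
  have hfin : ((Finset.univ.filter fun y : ι → F =>
      (hammingNorm y : ℝ) ≤ δ * n).card : ℝ) * B⁻¹ ≤ 1 := by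
    rw [← htot, ← nsmul_eq_mul, ← Finset.sum_const]
    refine (Finset.sum_le_sum fun y hy => hlow y (Finset.mem_filter.1 hy).2).trans ?_
    exact Finset.sum_le_sum_of_subset_of_nonneg (Finset.filter_subset _ _) fun y _ _ => hw y
  rwa [← div_eq_mul_inv, div_le_one hBpos] at hfin

section Coordinates

variable {F : Type*} [Field F] {m : ℕ} {lam : Fˣ}

theorem monic_X_pow_sub_C_unit (hm : 0 < m) : ((X : F[X]) ^ m - C (lam : F)).Monic :=
  monic_X_pow_sub_C _ hm.ne'

theorem smul_eq_mk_mul {I : Ideal F[X]} (f : F[X]) (c : F[X] ⧸ I) :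
    f • c = Ideal.Quotient.mk I f * c := by
  obtain ⟨u, rfl⟩ := Ideal.Quotient.mk_surjective c
  rfl

theorem polyRep_mk {g : F[X]} (hg : g.Monic) (f : F[X]) :
    polyRep g (Ideal.Quotient.mk _ f) = f %ₘ g := by
  unfold polyRep
  have h := Function.surjInv_eq (Ideal.Quotient.mk_surjective (I := Ideal.span {g}))
    (Ideal.Quotient.mk _ f)
  rw [Ideal.Quotient.eq, Ideal.mem_span_singleton] at h
  rw [← sub_eq_zero, ← sub_modByMonic]
  exact (modByMonic_eq_zero_iff_dvd hg).2 h

theorem mk_polyRep {g : F[X]} (hg : g.Monic) (c : F[X] ⧸ Ideal.span {g}) :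
    Ideal.Quotient.mk _ (polyRep g c) = c := by
  obtain ⟨f, rfl⟩ := Ideal.Quotient.mk_surjective c
  rw [polyRep_mk hg, Ideal.Quotient.eq, Ideal.mem_span_singleton]
  refine ⟨-(f /ₘ g), ?_⟩
  linear_combination modByMonic_add_div f g

/-- The coordinate vector of a class modulo `X ^ m - lam`. -/
noncomputable def coord (c : QA F m (lam : F)) (i : Fin m) : F :=
  (polyRep ((X : F[X]) ^ m - C (lam : F)) c).coeff i

theorem natDegree_polyRep_lt (hm : 0 < m) (c : QA F m (lam : F)) :
    (polyRep ((X : F[X]) ^ m - C (lam : F)) c).natDegree < m := by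
  have h := natDegree_modByMonic_lt
    (Function.surjInv Ideal.Quotient.mk_surjective c) (monic_X_pow_sub_C_unit (lam := lam) hm)
    (fun h => by
      have := congrArg natDegree h
      rw [natDegree_X_pow_sub_C, natDegree_one] at this
      omega)
  rwa [natDegree_X_pow_sub_C] at h

theorem qwt_eq_hammingNorm [DecidableEq F] (hm : 0 < m) (c : QA F m (lam : F)) :
    qwt ((X : F[X]) ^ m - C (lam : F)) c = hammingNorm (coord c) := by
  unfold qwt hammingNorm
  symm
  refine Finset.card_bij (fun i _ => (i : ℕ)) ?_ ?_ ?_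
  · intro i hi
    simpa [coord] using (Finset.mem_filter.1 hi).2
  · intro i _ j _ h
    exact Fin.ext h
  · intro n hn
    have hlt : n < m :=
      (le_natDegree_of_mem_supp n hn).trans_lt (natDegree_polyRep_lt hm c)
    exact ⟨⟨n, hlt⟩, Finset.mem_filter.2 ⟨Finset.mem_univ _, mem_support_iff.1 hn⟩, rfl⟩

theorem polyRep_X_smul (hm : 0 < m) (c : QA F m (lam : F)) :
    polyRep ((X : F[X]) ^ m - C (lam : F)) ((X : F[X]) • c) =
      X * polyRep ((X : F[X]) ^ m - C (lam : F)) c -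
        C ((polyRep ((X : F[X]) ^ m - C (lam : F)) c).coeff (m - 1)) *
          ((X : F[X]) ^ m - C (lam : F)) := by
  set P := (X : F[X]) ^ m - C (lam : F) with hP
  have hmon : P.Monic := monic_X_pow_sub_C_unit hm
  set u := polyRep P c with hu
  have hdeg : u.natDegree < m := natDegree_polyRep_lt hm c
  have h1 : (X : F[X]) • c = Ideal.Quotient.mk _ (X * u - C (u.coeff (m - 1)) * P) := by
    conv_lhs => rw [← mk_polyRep hmon c]
    rw [← hu, smul_eq_mk_mul, ← map_mul, Ideal.Quotient.eq, Ideal.mem_span_singleton]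
    exact ⟨C (u.coeff (m - 1)), by ring⟩
  rw [h1, polyRep_mk hmon, modByMonic_eq_self_iff hmon]
  have hPd : P.degree = (m : ℕ) := degree_X_pow_sub_C hm _
  rw [hPd, degree_lt_iff_coeff_zero]
  intro k hk
  obtain ⟨k, rfl⟩ : ∃ j, k = j + 1 := ⟨k - 1, by omega⟩
  rw [coeff_sub, coeff_X_mul, coeff_C_mul, hP, coeff_sub, coeff_X_pow, coeff_C_succ]
  by_cases h : k + 1 = m
  · subst h
    simp
  · rw [if_neg h, coeff_eq_zero_of_natDegree_lt (by omega)]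
    simp

theorem coord_X_smul [NeZero m] (c : QA F m (lam : F)) (i : Fin m) :
    coord ((X : F[X]) • c) (i + 1) = 0 ↔ coord c i = 0 := by
  have hm : 0 < m := NeZero.pos m
  have hdeg := natDegree_polyRep_lt hm c
  unfold coord
  rw [polyRep_X_smul hm]
  have hi := i.isLt
  by_cases h : (i : ℕ) + 1 = m
  · have : ((i + 1 : Fin m) : ℕ) = 0 := by
      rw [Fin.val_add, Fin.val_one', Nat.add_mod_mod, h, Nat.mod_self]
    rw [this, show m - 1 = (i : ℕ) by omega, coeff_sub, coeff_X_mul_zero, coeff_C_mul, coeff_sub,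
      coeff_X_pow, if_neg hm.ne, coeff_C_zero]
    simp
  · have : ((i + 1 : Fin m) : ℕ) = i + 1 := by
      rw [Fin.val_add, Fin.val_one', Nat.add_mod_mod, Nat.mod_eq_of_lt (by omega)]
    rw [this, coeff_sub, coeff_X_mul, coeff_C_mul, coeff_sub, coeff_X_pow, if_neg h, coeff_C_succ]
    simp

theorem coord_X_pow_smul [NeZero m] (c : QA F m (lam : F)) (s i : Fin m) :
    coord ((X : F[X]) ^ (s : ℕ) • c) (i + s) = 0 ↔ coord c i = 0 := by
  have : ∀ k : ℕ, coord ((X : F[X]) ^ k • c) (i + Fin.ofNat m k) = 0 ↔ coord c i = 0 := by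
    intro k
    induction k with
    | zero => simp
    | succ k ih =>
      have : Fin.ofNat m (k + 1) = Fin.ofNat m k + 1 := by
        apply Fin.ext
        simp [Fin.val_add]
      rw [pow_succ', mul_smul, this, ← add_assoc, coord_X_smul, ih]
  simpa using this s

theorem coord_injective (hm : 0 < m) : Function.Injective (coord : QA F m (lam : F) → Fin m → F) := by
  intro c c' h
  have hmon : ((X : F[X]) ^ m - C (lam : F)).Monic := monic_X_pow_sub_C_unit hm
  rw [← mk_polyRep hmon c, ← mk_polyRep hmon c']
  congr 1
  ext n
  by_cases hn : n < m
  · exact congrFun h ⟨n, hn⟩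
  · rw [coeff_eq_zero_of_natDegree_lt, coeff_eq_zero_of_natDegree_lt]
    · exact (natDegree_polyRep_lt hm c').trans_le (not_lt.1 hn)
    · exact (natDegree_polyRep_lt hm c).trans_le (not_lt.1 hn)

theorem coord_sub (c c' : QA F m (lam : F)) (hm : 0 < m) (i : Fin m) :
    coord (c - c') i = coord c i - coord c' i := by
  have hmon : ((X : F[X]) ^ m - C (lam : F)).Monic := monic_X_pow_sub_C_unit hm
  obtain ⟨f, rfl⟩ := Ideal.Quotient.mk_surjective c
  obtain ⟨f', rfl⟩ := Ideal.Quotient.mk_surjective c'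
  unfold coord
  rw [← map_sub, polyRep_mk hmon, polyRep_mk hmon, polyRep_mk hmon, sub_modByMonic, coeff_sub]

theorem X_pow_smul_injective (hm : 0 < m) (s : ℕ) :
    Function.Injective fun c : QA F m (lam : F) => (X : F[X]) ^ s • c := by
  have hunit : IsUnit (Ideal.Quotient.mk (Ideal.span {(X : F[X]) ^ m - C (lam : F)}) X) := by
    refine IsUnit.of_mul_eq_one (Ideal.Quotient.mk _ (C ((lam⁻¹ : Fˣ) : F) * X ^ (m - 1))) ?_
    rw [← map_mul, ← map_one (Ideal.Quotient.mk _), Ideal.Quotient.eq, Ideal.mem_span_singleton]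
    refine ⟨C ((lam⁻¹ : Fˣ) : F), ?_⟩
    have h1 : (C (lam : F) : F[X]) * C ((lam⁻¹ : Fˣ) : F) = 1 := by
      rw [← C_mul, Units.mul_inv, C_1]
    have h2 : (X : F[X]) ^ m = X * X ^ (m - 1) := by
      rw [← pow_succ', Nat.sub_add_cancel hm]
    rw [h2]
    linear_combination h1
  intro c c' h
  simp only [smul_eq_mk_mul, map_pow] at h
  exact (hunit.pow s).mul_left_cancel h

/-- The last `d` coordinates of `X ^ s • c`. -/
noncomputable def window (d : ℕ) (hd : d ≤ m) (s : Fin m) (c : QA F m (lam : F)) (j : Fin d) : F :=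
  coord ((X : F[X]) ^ (s : ℕ) • c) ⟨m - d + j, by omega⟩

theorem eq_zero_of_coord_eq_zero {h : F[X]} (hm : 0 < m) (hh : h.Monic) (c : QA F m (lam : F))
    (hc : h • c = 0) (hd : h.natDegree ≤ m)
    (h0 : ∀ j : Fin h.natDegree, coord c ⟨m - h.natDegree + j, by omega⟩ = 0) : c = 0 := by
  have hmon : ((X : F[X]) ^ m - C (lam : F)).Monic := monic_X_pow_sub_C_unit hm
  set P := (X : F[X]) ^ m - C (lam : F) with hP
  set u := polyRep P c with hu
  have hdvd : P ∣ h * u := by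
    rw [← mk_polyRep hmon c, ← hu, smul_eq_mk_mul, ← map_mul, Ideal.Quotient.eq_zero_iff_mem, Ideal.mem_span_singleton] at hc
    exact hc
  suffices hu0 : u = 0 by rw [← mk_polyRep hmon c, ← hu, hu0, map_zero]
  by_contra hne
  have hlt : u.natDegree < m - h.natDegree := by
    by_contra hcon
    have hum : u.natDegree < m := natDegree_polyRep_lt hm c
    have := h0 ⟨u.natDegree - (m - h.natDegree), by omega⟩
    change u.coeff (m - h.natDegree + (u.natDegree - (m - h.natDegree))) = 0 at this
    rw [show m - h.natDegree + (u.natDegree - (m - h.natDegree)) = u.natDegree by omega,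
      coeff_natDegree, leadingCoeff_eq_zero] at this
    exact hne this
  have h1 := natDegree_le_of_dvd hdvd (mul_ne_zero hh.ne_zero hne)
  rw [natDegree_mul hh.ne_zero hne, hP, natDegree_X_pow_sub_C] at h1
  omega

theorem window_injOn {h : F[X]} (hm : 0 < m) (hh : h.Monic) (hd : h.natDegree ≤ m) (s : Fin m)
    {c c' : QA F m (lam : F)} (hc : h • c = 0) (hc' : h • c' = 0)
    (hw : window h.natDegree hd s c = window h.natDegree hd s c') : c = c' := by
  refine X_pow_smul_injective hm (s : ℕ) (sub_eq_zero.1 ?_)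
  refine eq_zero_of_coord_eq_zero hm hh _ ?_ hd fun j => ?_
  · dsimp only
    rw [smul_sub, smul_comm, hc, smul_comm, hc']
    simp
  · rw [coord_sub _ _ hm, sub_eq_zero]
    exact congrFun hw j

theorem sum_hammingNorm_window [DecidableEq F] [NeZero m] {d : ℕ} (hd : d ≤ m)
    (c : QA F m (lam : F)) :
    ∑ s, hammingNorm (window d hd s c) = d * hammingNorm (coord c) := by
  simp only [hammingNorm, Finset.card_filter]
  rw [Finset.sum_comm]
  have : ∀ j : Fin d, (∑ s, if window d hd s c j ≠ 0 then 1 else 0) =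
      ∑ i, if coord c i ≠ 0 then 1 else 0 := by
    intro j
    set t : Fin m := ⟨m - d + j, by omega⟩ with ht
    refine Fintype.sum_equiv (Equiv.subLeft t) _ _ fun s => ?_
    have := coord_X_pow_smul c s (t - s)
    rw [sub_add_cancel] at this
    simp only [window, ne_eq, ← ht, this, Equiv.subLeft_apply]
  rw [Finset.sum_congr rfl fun j _ => this j]
  simp

end Coordinates

section Counting

variable {F : Type*} [Field F] {m : ℕ} {lam : Fˣ}

/-- Reduction from `F[X]/⟨X ^ m - lam⟩` to `F[X]/⟨g⟩`, for a divisor `g` of `X ^ m - lam`. -/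
noncomputable def reduction {g : F[X]} (hg : g ∣ (X : F[X]) ^ m - C (lam : F)) :
    QA F m (lam : F) →ₗ[F[X]] F[X] ⧸ Ideal.span {g} :=
  (Ideal.Quotient.factorₐ F[X] (Ideal.span_singleton_le_span_singleton.2 hg)).toLinearMap

theorem reduction_mk {g : F[X]} (hg : g ∣ (X : F[X]) ^ m - C (lam : F)) (f : F[X]) :
    reduction hg (Ideal.Quotient.mk _ f) = Ideal.Quotient.mk _ f := rfl

theorem mk_mem_ker_reduction {g : F[X]} (hg : g ∣ (X : F[X]) ^ m - C (lam : F)) (f : F[X]) :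
    Ideal.Quotient.mk _ f ∈ LinearMap.ker (reduction hg) ↔ g ∣ f := by
  rw [LinearMap.mem_ker, reduction_mk, Ideal.Quotient.eq_zero_iff_mem, Ideal.mem_span_singleton]

/-- A pair of classes whose total Hamming weight is at most a fraction `δ` of the length. -/
def IsLight (δ : ℝ) (u v : QA F m (lam : F)) : Prop :=
  (qwt ((X : F[X]) ^ m - C (lam : F)) u + qwt ((X : F[X]) ^ m - C (lam : F)) v : ℝ) ≤
    δ * (2 * m)

theorem exists_light_window [DecidableEq F] [NeZero m] {δ : ℝ} {d : ℕ} (hd : d ≤ m)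
    {u v : QA F m (lam : F)} (h : IsLight δ u v) :
    ∃ s : Fin m, (hammingNorm (Sum.elim (window d hd s u) (window d hd s v)) : ℝ) ≤
      δ * Fintype.card (Fin d ⊕ Fin d) := by
  have hm : 0 < m := NeZero.pos m
  have hsplit : ∀ s, hammingNorm (Sum.elim (window d hd s u) (window d hd s v)) =
      hammingNorm (window d hd s u) + hammingNorm (window d hd s v) := by
    intro s
    simp only [hammingNorm, Finset.card_filter, Fintype.sum_sum_type, Sum.elim_inl, Sum.elim_inr]
    rfl
  have hle : ∑ s : Fin m, (hammingNorm (Sum.elim (window d hd s u) (window d hd s v)) : ℝ) ≤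
      ∑ s : Fin m, δ * Fintype.card (Fin d ⊕ Fin d) := by
    rw [IsLight, qwt_eq_hammingNorm hm, qwt_eq_hammingNorm hm] at h
    rw [← Nat.cast_sum, Finset.sum_congr rfl fun s _ => hsplit s, Finset.sum_add_distrib,
      sum_hammingNorm_window, sum_hammingNorm_window]
    simp only [Finset.sum_const, Finset.card_univ, Fintype.card_fin, Fintype.card_sum,
      nsmul_eq_mul]
    push_cast
    nlinarith [mul_le_mul_of_nonneg_left h (Nat.cast_nonneg (α := ℝ) d)]
  obtain ⟨s, -, hs⟩ := Finset.exists_le_of_sum_le Finset.univ_nonempty hle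
  exact ⟨s, hs⟩

variable [Fintype F]

theorem finite_QA (hm : 0 < m) : Finite (QA F m (lam : F)) :=
  Finite.of_injective _ (coord_injective hm)

theorem natCard_QA (hm : 0 < m) : Nat.card (QA F m (lam : F)) = Fintype.card F ^ m := by
  have := finite_QA (lam := lam) hm
  have h := Module.natCard_eq_pow_finrank (K := F) (V := QA F m (lam : F))
  rwa [finrank_quotient_span_eq_natDegree, natDegree_X_pow_sub_C,
    Nat.card_eq_fintype_card (α := F)] at h

theorem ncard_light_pairs_le {δ : ℝ} (hm : 0 < m) (hδ0 : 0 < δ)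
    (hδ1 : δ < 1 - 1 / (Fintype.card F : ℝ)) {h : F[X]} (hh : h.Monic) (hd : h.natDegree ≤ m) :
    ({p : QA F m (lam : F) × QA F m (lam : F) |
        h • p.1 = 0 ∧ h • p.2 = 0 ∧ IsLight δ p.1 p.2}.ncard : ℝ) ≤
      m * (Fintype.card F : ℝ) ^ (2 * (h.natDegree : ℝ) * entropy (Fintype.card F) δ) := by
  classical
  have : NeZero m := ⟨hm.ne'⟩
  have := finite_QA (lam := lam) hm
  set d := h.natDegree with hdd
  set B : Finset (Fin d ⊕ Fin d → F) := Finset.univ.filter fun y =>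
    (hammingNorm y : ℝ) ≤ δ * Fintype.card (Fin d ⊕ Fin d) with hB
  have hBcard := card_hammingNorm_le (F := F) (ι := Fin d ⊕ Fin d) hδ0 hδ1
  rw [← hB] at hBcard
  let S : Fin m → Set (QA F m (lam : F) × QA F m (lam : F)) := fun s =>
    {p | h • p.1 = 0 ∧ h • p.2 = 0 ∧ Sum.elim (window d hd s p.1) (window d hd s p.2) ∈ B}
  have hS : ∀ s, (S s).ncard ≤ B.card := by
    intro s
    rw [← Set.ncard_coe_finset]
    refine Set.ncard_le_ncard_of_injOn
      (fun p => Sum.elim (window d hd s p.1) (window d hd s p.2)) (fun p hp => hp.2.2) ?_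
      (Set.toFinite _)
    intro p hp p' hp' heq
    have h1 : window d hd s p.1 = window d hd s p'.1 := funext fun j => congrFun heq (Sum.inl j)
    have h2 : window d hd s p.2 = window d hd s p'.2 := funext fun j => congrFun heq (Sum.inr j)
    exact Prod.ext (window_injOn hm hh hd s hp.1 hp'.1 h1)
      (window_injOn hm hh hd s hp.2.1 hp'.2.1 h2)
  have hcover : {p : QA F m (lam : F) × QA F m (lam : F) |
      h • p.1 = 0 ∧ h • p.2 = 0 ∧ IsLight δ p.1 p.2} ⊆ ⋃ s, S s := by
    rintro p ⟨h1, h2, hl⟩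
    obtain ⟨s, hs⟩ := exists_light_window hd hl
    exact Set.mem_iUnion.2 ⟨s, h1, h2, by simpa [hB] using hs⟩
  have hnat := (Set.ncard_le_ncard hcover (Set.toFinite _)).trans
    ((Set.ncard_iUnion_le_of_fintype S).trans (Finset.sum_le_sum fun s _ => hS s))
  rw [Finset.sum_const, Finset.card_univ, Fintype.card_fin, smul_eq_mul] at hnat
  calc _ ≤ ((m * B.card : ℕ) : ℝ) := by exact_mod_cast hnat
    _ = m * (B.card : ℝ) := by push_cast; rfl
    _ ≤ _ := by
      refine mul_le_mul_of_nonneg_left (hBcard.trans_eq ?_) (Nat.cast_nonneg _)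
      simp only [Fintype.card_sum, Fintype.card_fin]
      push_cast
      ring_nf

theorem finrank_ker_reduction (hm : 0 < m) {g : F[X]}
    (hg : g ∣ (X : F[X]) ^ m - C (lam : F)) :
    g.natDegree + Module.finrank F (LinearMap.ker (reduction hg)) = m := by
  have := finite_QA (lam := lam) hm
  have hfin : Module.Finite F (QA F m (lam : F)) := Module.Finite.of_finite
  have h := LinearMap.finrank_range_add_finrank_ker ((reduction hg).restrictScalars F)
  have hsurj : LinearMap.range ((reduction hg).restrictScalars F) = ⊤ := by
    rw [LinearMap.range_eq_top]
    intro y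
    obtain ⟨f, rfl⟩ := Ideal.Quotient.mk_surjective y
    exact ⟨Ideal.Quotient.mk _ f, rfl⟩
  rw [hsurj, finrank_top, finrank_quotient_span_eq_natDegree,
    finrank_quotient_span_eq_natDegree, natDegree_X_pow_sub_C] at h
  exact h

theorem ncard_mul_eq_le (hm : 0 < m) {h : F[X]} (hh : h ∣ (X : F[X]) ^ m - C (lam : F))
    {u : QA F m (lam : F)} (hu : ∀ f : F[X], f • u = 0 → h ∣ f) (v : QA F m (lam : F)) :
    {a : QA F m (lam : F) | a * u = v}.ncard ≤ Fintype.card F ^ (m - h.natDegree) := by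
  have := finite_QA (lam := lam) hm
  rcases Set.eq_empty_or_nonempty {a : QA F m (lam : F) | a * u = v} with h0 | ⟨a₀, ha₀⟩
  · simp [h0]
  have hcard : ((LinearMap.ker (reduction hh) : Submodule F[X] (QA F m (lam : F))) :
      Set (QA F m (lam : F))).ncard = Fintype.card F ^ (m - h.natDegree) := by
    have h1 := Module.natCard_eq_pow_finrank (K := F) (V := LinearMap.ker (reduction hh))
    have h2 := finrank_ker_reduction hm hh
    rw [show Module.finrank F (LinearMap.ker (reduction hh)) = m - h.natDegree by omega,
      Nat.card_eq_fintype_card (α := F)] at h1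
    exact h1
  rw [← hcard]
  refine Set.ncard_le_ncard_of_injOn (fun a => a - a₀) ?_ (fun a _ b _ hab => sub_left_injective hab)
    (Set.toFinite _)
  intro a ha
  obtain ⟨f, hf⟩ := Ideal.Quotient.mk_surjective (a - a₀)
  change a - a₀ ∈ LinearMap.ker (reduction hh)
  rw [← hf, mk_mem_ker_reduction]
  refine hu f ?_
  have h1 : a * u = v := ha
  have h2 : a₀ * u = v := ha₀
  rw [smul_eq_mk_mul, hf, sub_mul, h1, h2, sub_self]

theorem ncard_light_multipliers_le {δ : ℝ} (hm : 0 < m) (hδ0 : 0 < δ)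
    (hδ1 : δ < 1 - 1 / (Fintype.card F : ℝ)) {h : F[X]} (hh : h.Monic)
    (hdvd : h ∣ (X : F[X]) ^ m - C (lam : F)) :
    ({a : QA F m (lam : F) | ∃ u, (∀ f : F[X], f • u = 0 ↔ h ∣ f) ∧
        IsLight δ u (a * u)}.ncard : ℝ) ≤
      m * (Fintype.card F : ℝ) ^ m * (Fintype.card F : ℝ) ^
        (-((1 - 2 * entropy (Fintype.card F) δ) * h.natDegree)) := by
  classical
  have := finite_QA (lam := lam) hm
  have hd : h.natDegree ≤ m := by
    have := natDegree_le_of_dvd hdvd (monic_X_pow_sub_C_unit hm).ne_zero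
    rwa [natDegree_X_pow_sub_C] at this
  set q := Fintype.card F with hq
  have hq0 : (0 : ℝ) < q := by exact_mod_cast Fintype.card_pos
  set L := {p : QA F m (lam : F) × QA F m (lam : F) |
    h • p.1 = 0 ∧ h • p.2 = 0 ∧ IsLight δ p.1 p.2} with hL
  have hLc : (L.ncard : ℝ) ≤ _ := ncard_light_pairs_le hm hδ0 hδ1 hh hd
  have hLfin : L.Finite := Set.toFinite _
  let A : QA F m (lam : F) × QA F m (lam : F) → Set (QA F m (lam : F)) := fun p =>
    {a | (∀ f : F[X], f • p.1 = 0 ↔ h ∣ f) ∧ a * p.1 = p.2}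
  have hA : ∀ p, (A p).ncard ≤ q ^ (m - h.natDegree) := by
    intro p
    by_cases hp : ∀ f : F[X], f • p.1 = 0 ↔ h ∣ f
    · exact (Set.ncard_le_ncard (fun a ha => ha.2) (Set.toFinite _)).trans
        (ncard_mul_eq_le hm hdvd (fun f => (hp f).1) p.2)
    · have : A p = ∅ := Set.eq_empty_of_forall_notMem fun a ha => hp ha.1
      simp [this]
  have hcover : {a : QA F m (lam : F) | ∃ u, (∀ f : F[X], f • u = 0 ↔ h ∣ f) ∧
      IsLight δ u (a * u)} ⊆ ⋃ p ∈ hLfin.toFinset, A p := by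
    rintro a ⟨u, hu, hl⟩
    have h0 : h • u = 0 := (hu h).2 dvd_rfl
    refine Set.mem_biUnion (x := (u, a * u)) ?_ ⟨hu, rfl⟩
    simp only [Finset.mem_coe, Set.Finite.mem_toFinset]
    refine ⟨h0, ?_, hl⟩
    change h • (a * u) = 0
    rw [smul_eq_mk_mul] at h0 ⊢
    rw [mul_left_comm, h0, mul_zero]
  have hnat := (Set.ncard_le_ncard hcover (Set.toFinite _)).trans
    ((Finset.set_ncard_biUnion_le _ A).trans (Finset.sum_le_sum fun p _ => hA p))
  rw [Finset.sum_const, smul_eq_mul, ← Set.ncard_eq_toFinset_card L] at hnat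
  calc _ ≤ ((L.ncard * q ^ (m - h.natDegree) : ℕ) : ℝ) := by exact_mod_cast hnat
    _ = (L.ncard : ℝ) * (q : ℝ) ^ (m - h.natDegree) := by push_cast; rfl
    _ ≤ (m * (q : ℝ) ^ (2 * (h.natDegree : ℝ) * entropy q δ)) * (q : ℝ) ^ (m - h.natDegree) :=
      mul_le_mul_of_nonneg_right hLc (by positivity)
    _ = _ := by
      rw [← Real.rpow_natCast, ← Real.rpow_natCast, mul_assoc, mul_assoc (m : ℝ),
        ← Real.rpow_add hq0, ← Real.rpow_add hq0, Nat.cast_sub hd]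
      ring_nf

end Counting

section Existence

open UniqueFactorizationMonoid

variable {F : Type*} [Field F] {m : ℕ} {lam : Fˣ}

theorem exists_monic_annihilator (hm : 0 < m) (u : QA F m (lam : F)) :
    ∃ h : F[X], h.Monic ∧ ∀ f : F[X], f • u = 0 ↔ h ∣ f := by
  classical
  set I := Ideal.torsionOf F[X] (QA F m (lam : F)) u with hI
  set g := Submodule.IsPrincipal.generator I with hg
  have hmem : ∀ f : F[X], f • u = 0 ↔ g ∣ f := fun f => by
    rw [← Submodule.IsPrincipal.mem_iff_generator_dvd I, hI, Ideal.mem_torsionOf_iff]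
  have hg0 : g ≠ 0 := by
    intro h0
    have hP : ((X : F[X]) ^ m - C (lam : F)) • u = 0 := by
      rw [smul_eq_mk_mul, Ideal.Quotient.eq_zero_iff_mem.2 (Ideal.mem_span_singleton_self _),
        zero_mul]
    rw [hmem, h0, zero_dvd_iff] at hP
    exact (monic_X_pow_sub_C_unit hm).ne_zero hP
  exact ⟨normalize g, monic_normalize hg0, fun f => by rw [hmem, normalize_dvd_iff]⟩

variable [Fintype F]

theorem exists_multiplier [DecidableEq F] {δ E : ℝ} (hm : 0 < m) (hδ0 : 0 < δ)
    (hδ1 : δ < 1 - 1 / (Fintype.card F : ℝ))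
    (hent : entropy (Fintype.card F) δ < 1 / 2) {G H : F[X]} (hH : H.Monic)
    (hGH : G * H = (X : F[X]) ^ m - C (lam : F))
    (hE : ∀ h : F[X], h.Monic → h ∣ H → h ≠ 1 → E ≤ h.natDegree)
    (hlt : (2 : ℝ) ^ (Multiset.card (normalizedFactors H)) * (m * (Fintype.card F : ℝ) ^
      (-((1 - 2 * entropy (Fintype.card F) δ) * E))) < 1) :
    ∃ a : QA F m (lam : F), ∀ u ∈ LinearMap.ker (reduction (Dvd.intro H hGH)), u ≠ 0 →
      ¬ IsLight δ u (a * u) := by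
  have := finite_QA (lam := lam) hm
  set q := Fintype.card F with hq
  set ε := 1 - 2 * entropy q δ with hε
  have hε0 : 0 < ε := by linarith
  have hq1 : (1 : ℝ) < q := by exact_mod_cast Fintype.one_lt_card
  have hq0 : (0 : ℝ) < q := by linarith
  let T : Finset F[X] := ((normalizedFactors H).powerset.map Multiset.prod).toFinset
  have hTcard : T.card ≤ 2 ^ Multiset.card (normalizedFactors H) := by
    refine (Multiset.toFinset_card_le _).trans ?_
    rw [Multiset.card_map, Multiset.card_powerset]
  have hmemT : ∀ h : F[X], h.Monic → h ∣ H → h ∈ T := by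
    intro h hh hdvd
    rw [Multiset.mem_toFinset, Multiset.mem_map]
    refine ⟨normalizedFactors h, Multiset.mem_powerset.2
      ((dvd_iff_normalizedFactors_le_normalizedFactors hh.ne_zero hH.ne_zero).1 hdvd), ?_⟩
    rw [prod_normalizedFactors_eq hh.ne_zero, hh.normalize_eq_self]
  let A : F[X] → Set (QA F m (lam : F)) := fun h => {a | (h.Monic ∧ h ∣ H ∧ h ≠ 1) ∧
    ∃ u, (∀ f : F[X], f • u = 0 ↔ h ∣ f) ∧ IsLight δ u (a * u)}
  set b : ℝ := m * (q : ℝ) ^ (-(ε * E)) with hb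
  have hA : ∀ h, ((A h).ncard : ℝ) ≤ (q : ℝ) ^ m * b := by
    intro h
    by_cases hh : h.Monic ∧ h ∣ H ∧ h ≠ 1
    · have h1 : ((A h).ncard : ℝ) ≤ _ :=
        (Nat.cast_le.2 (Set.ncard_le_ncard (fun a ha => ha.2) (Set.toFinite _))).trans
        (ncard_light_multipliers_le (lam := lam) hm hδ0 hδ1 hh.1
          (hh.2.1.trans (Dvd.intro_left G hGH)))
      refine h1.trans ?_
      rw [hb, mul_comm (m : ℝ), mul_assoc]
      have := hE h hh.1 hh.2.1 hh.2.2
      gcongr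
      exact hq1.le
    · have : A h = ∅ := Set.eq_empty_of_forall_notMem fun a ha => hh ha.1
      rw [this, Set.ncard_empty, Nat.cast_zero]
      positivity
  have hcard : ((⋃ h ∈ T, A h).ncard : ℝ) < (q : ℝ) ^ m := by
    calc ((⋃ h ∈ T, A h).ncard : ℝ) ≤ ((∑ h ∈ T, (A h).ncard : ℕ) : ℝ) := by
          exact_mod_cast Finset.set_ncard_biUnion_le T A
      _ = ∑ h ∈ T, ((A h).ncard : ℝ) := by push_cast; rfl
      _ ≤ ∑ h ∈ T, (q : ℝ) ^ m * b := Finset.sum_le_sum fun h _ => hA h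
      _ = T.card * ((q : ℝ) ^ m * b) := by rw [Finset.sum_const, nsmul_eq_mul]
      _ ≤ 2 ^ Multiset.card (normalizedFactors H) * ((q : ℝ) ^ m * b) := by
          refine mul_le_mul_of_nonneg_right (by exact_mod_cast hTcard) (by positivity)
      _ = (q : ℝ) ^ m * (2 ^ Multiset.card (normalizedFactors H) * b) := by ring
      _ < (q : ℝ) ^ m := mul_lt_of_lt_one_right (by positivity) hlt
  have hne : (⋃ h ∈ T, A h) ≠ Set.univ := by
    intro h
    rw [h, Set.ncard_univ, natCard_QA hm] at hcard
    push_cast at hcard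
    exact lt_irrefl _ hcard
  obtain ⟨a, ha⟩ := (Set.ne_univ_iff_exists_notMem _).1 hne
  refine ⟨a, fun u hu hu0 hl => ha ?_⟩
  obtain ⟨h, hh, hann⟩ := exists_monic_annihilator hm u
  have hHu : H • u = 0 := by
    obtain ⟨f, rfl⟩ := Ideal.Quotient.mk_surjective u
    obtain ⟨w, rfl⟩ := (mk_mem_ker_reduction _ f).1 hu
    rw [smul_eq_mk_mul, ← map_mul, Ideal.Quotient.eq_zero_iff_mem, Ideal.mem_span_singleton]
    exact ⟨w, by rw [← hGH]; ring⟩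
  have hdvd := (hann H).1 hHu
  refine Set.mem_biUnion (Finset.mem_coe.2 (hmemT h hh hdvd)) ⟨⟨hh, hdvd, ?_⟩, u, hann, hl⟩
  rintro rfl
  exact hu0 (by simpa using (hann 1).2 dvd_rfl)

theorem exists_code [DecidableEq F] {δ E : ℝ} (hm : 0 < m) (hδ0 : 0 < δ)
    (hδ1 : δ < 1 - 1 / (Fintype.card F : ℝ))
    (hent : entropy (Fintype.card F) δ < 1 / 2) {G H : F[X]} (hH : H.Monic)
    (hGH : G * H = (X : F[X]) ^ m - C (lam : F))
    (hE : ∀ h : F[X], h.Monic → h ∣ H → h ≠ 1 → E ≤ h.natDegree)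
    (hlt : (2 : ℝ) ^ (Multiset.card (normalizedFactors H)) * (m * (Fintype.card F : ℝ) ^
      (-((1 - 2 * entropy (Fintype.card F) δ) * E))) < 1) :
    ∃ Cd : Submodule F[X] (QA F m (lam : F) × QA F m (lam : F)),
      (∀ c ∈ Cd, c ≠ 0 → ¬ IsLight δ c.1 c.2) ∧ G.natDegree + Module.finrank F Cd = m := by
  obtain ⟨a, ha⟩ := exists_multiplier hm hδ0 hδ1 hent hH hGH hE hlt
  set J := LinearMap.ker (reduction (Dvd.intro H hGH)) with hJ
  let φ : QA F m (lam : F) →ₗ[F[X]] QA F m (lam : F) × QA F m (lam : F) :=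
    LinearMap.prod LinearMap.id (LinearMap.mulLeft F[X] a)
  have hφ : Function.Injective φ := fun x y h => congrArg Prod.fst h
  refine ⟨J.map φ, ?_, ?_⟩
  · rintro _ ⟨u, hu, rfl⟩ hne
    exact ha u hu fun h0 => hne (by rw [h0, map_zero])
  · rw [← LinearEquiv.finrank_eq ((Submodule.equivMapOfInjective φ hφ J).restrictScalars F)]
    exact finrank_ker_reduction hm _

end Existence

section Factorization

open UniqueFactorizationMonoid

theorem pow_le_of_dvd_pow_sub_one {q ℓ n t : ℕ} [Fact ℓ.Prime] (hℓ : Odd ℓ) (hq : 1 < q)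
    (hqℓ : ¬ ℓ ∣ q) (hn : n ≠ 0) (h : ℓ ^ t ∣ q ^ n - 1) :
    ℓ ^ t ≤ ℓ ^ padicValNat ℓ (q ^ (ℓ - 1) - 1) * n := by
  have hp : ℓ.Prime := Fact.out
  have hℓ1 : ℓ - 1 ≠ 0 := by have := hp.two_le; omega
  have h1 : 1 < q ^ (ℓ - 1) := Nat.one_lt_pow hℓ1 hq
  have hferm : ℓ ∣ q ^ (ℓ - 1) - 1 := by
    have := Nat.ModEq.pow_totient ((Nat.Prime.coprime_iff_not_dvd hp).2 hqℓ).symm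
    rw [Nat.totient_prime hp] at this
    exact (Nat.modEq_iff_dvd' h1.le).1 this.symm
  have hnd : ¬ ℓ ∣ q ^ (ℓ - 1) := fun hd => hqℓ (hp.dvd_of_dvd_pow hd)
  have hlte := padicValNat.pow_sub_pow hℓ h1 hferm hnd hn
  rw [one_pow] at hlte
  have hdvd : q ^ n - 1 ∣ (q ^ (ℓ - 1)) ^ n - 1 := by
    have := Nat.sub_dvd_pow_sub_pow (q ^ n) 1 (ℓ - 1)
    rwa [one_pow, ← pow_mul, mul_comm n, pow_mul] at this
  have h2 : 1 < (q ^ (ℓ - 1)) ^ n := Nat.one_lt_pow hn h1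
  have h3 := (padicValNat_dvd_iff_le (by omega)).1 (h.trans hdvd)
  refine Nat.le_of_dvd (Nat.mul_pos (pow_pos hp.pos _) (Nat.pos_of_ne_zero hn)) ?_
  rw [padicValNat_dvd_iff_le (mul_ne_zero (pow_ne_zero _ hp.ne_zero) hn),
    padicValNat.mul (pow_ne_zero _ hp.ne_zero) hn, padicValNat.prime_pow, ← hlte]
  exact h3

variable {F : Type*} [Field F]

theorem card_normalizedFactors_mul_le [DecidableEq F] {H : F[X]} (hH : H.Monic) {t A : ℕ}
    (h : ∀ f : F[X], Irreducible f → f ∣ H → t ≤ A * f.natDegree) :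
    Multiset.card (normalizedFactors H) * t ≤ A * H.natDegree := by
  have hprod : (normalizedFactors H).prod = H := by
    rw [prod_normalizedFactors_eq hH.ne_zero, hH.normalize_eq_self]
  conv_rhs => rw [← hprod, natDegree_multiset_prod _ (zero_notMem_normalizedFactors H),
    ← Multiset.sum_map_mul_left]
  rw [← smul_eq_mul, ← Multiset.card_map (fun f : F[X] => A * f.natDegree)]
  refine Multiset.card_nsmul_le_sum fun x hx => ?_
  obtain ⟨f, hf, rfl⟩ := Multiset.mem_map.1 hx
  exact h f (irreducible_of_normalized_factor f hf) (dvd_of_mem_normalizedFactors hf)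

variable [Fintype F]

/-- If `ℓ > |F|` is prime, then every irreducible factor of
`(X ^ (ℓ ^ k) - μ ^ (ℓ ^ k)) / (X ^ (ℓ ^ j) - μ ^ (ℓ ^ j))` has degree at least a constant
multiple of `ℓ ^ j`. -/
theorem pow_le_natDegree_of_irreducible {ℓ j r : ℕ} [Fact ℓ.Prime] (hℓ : Fintype.card F < ℓ)
    (μ : Fˣ) {f : F[X]} (hf : Irreducible f)
    (hdvd : f ∣ ∑ i ∈ Finset.range (ℓ ^ r),
      ((X : F[X]) ^ (ℓ ^ j)) ^ i * (C (μ : F) ^ (ℓ ^ j)) ^ (ℓ ^ r - 1 - i)) :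
    ℓ ^ j ≤ ℓ ^ padicValNat ℓ (Fintype.card F ^ (ℓ - 1) - 1) * f.natDegree := by
  set q := Fintype.card F with hq
  have hp : ℓ.Prime := Fact.out
  have hq1 : 1 < q := Fintype.one_lt_card
  have hqℓ : ¬ ℓ ∣ q := fun h => by have := Nat.le_of_dvd (by omega) h; omega
  have hodd : Odd ℓ := hp.odd_of_ne_two (by omega)
  have : Fact (Irreducible f) := ⟨hf⟩
  let K := AdjoinRoot f
  have hfinK : Module.Finite F K := (AdjoinRoot.powerBasis hf.ne_zero).finite
  have : Finite K := Module.finite_of_finite F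
  have : Fintype K := Fintype.ofFinite K
  have hcardK : Fintype.card K = q ^ f.natDegree := by
    rw [Module.card_eq_pow_finrank (K := F) (V := K)]
    congr 1
    exact finrank_quotient_span_eq_natDegree
  have hℓF : (ℓ : F) ≠ 0 := by
    intro h0
    have hcop : IsCoprime (ℓ : ℤ) (q : ℤ) :=
      Nat.isCoprime_iff_coprime.2 ((Nat.Prime.coprime_iff_not_dvd hp).2 hqℓ)
    obtain ⟨a, b, hab⟩ := hcop
    have := congrArg (Int.cast : ℤ → F) hab
    push_cast at this
    rw [h0, hq, FiniteField.cast_card_eq_zero] at this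
    simp at this
  have hℓK : (ℓ : K) ≠ 0 := by
    rw [← map_natCast (algebraMap F K)]
    exact (_root_.map_ne_zero _).2 hℓF
  set α : K := AdjoinRoot.root f with hα
  set y : K := algebraMap F K (μ : F) with hy
  have hy0 : y ≠ 0 := (_root_.map_ne_zero _).2 μ.ne_zero
  have hsum : ∑ i ∈ Finset.range (ℓ ^ r), (α ^ (ℓ ^ j)) ^ i * (y ^ (ℓ ^ j)) ^ (ℓ ^ r - 1 - i) = 0 := by
    have h0 : AdjoinRoot.mk f (∑ i ∈ Finset.range (ℓ ^ r),
      ((X : F[X]) ^ (ℓ ^ j)) ^ i * (C (μ : F) ^ (ℓ ^ j)) ^ (ℓ ^ r - 1 - i)) = 0 :=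
      AdjoinRoot.mk_eq_zero.2 hdvd
    simp only [map_sum, map_mul, map_pow, AdjoinRoot.mk_X, AdjoinRoot.mk_C] at h0
    exact h0
  have hne : α ^ (ℓ ^ j) ≠ y ^ (ℓ ^ j) := by
    intro h
    rw [h, geom_sum₂_self] at hsum
    refine mul_ne_zero ?_ (pow_ne_zero _ (pow_ne_zero _ hy0)) hsum
    push_cast
    exact pow_ne_zero _ hℓK
  have heq : α ^ (ℓ ^ (j + r)) = y ^ (ℓ ^ (j + r)) := by
    have := geom_sum₂_mul (α ^ (ℓ ^ j)) (y ^ (ℓ ^ j)) (ℓ ^ r)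
    rw [hsum, zero_mul, ← pow_mul, ← pow_mul, ← pow_add] at this
    exact (sub_eq_zero.1 this.symm)
  have hζ1 : (α / y) ^ (ℓ ^ (j + r)) = 1 := by
    rw [div_pow, heq, div_self (pow_ne_zero _ hy0)]
  have hζ2 : (α / y) ^ (ℓ ^ j) ≠ 1 := by
    rw [div_pow, Ne, div_eq_one_iff_eq (pow_ne_zero _ hy0)]
    exact hne
  have hζ0 : α / y ≠ 0 := by
    intro h
    rw [h, zero_pow (pow_ne_zero _ hp.ne_zero)] at hζ1
    exact zero_ne_one hζ1
  obtain ⟨t, -, ht⟩ := (Nat.dvd_prime_pow hp).1 (orderOf_dvd_of_pow_eq_one hζ1)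
  have hjt : j ≤ t := by
    by_contra hlt
    exact hζ2 (orderOf_dvd_iff_pow_eq_one.1 (ht ▸ pow_dvd_pow ℓ (by omega)))
  have hord : ℓ ^ j ∣ q ^ f.natDegree - 1 := by
    rw [← hcardK]
    exact (pow_dvd_pow ℓ hjt).trans
      (ht ▸ orderOf_dvd_of_pow_eq_one (FiniteField.pow_card_sub_one_eq_one _ hζ0))
  exact pow_le_of_dvd_pow_sub_one hodd hq1 hqℓ hf.natDegree_pos.ne' hord

theorem exists_factorization {ℓ : ℕ} [Fact ℓ.Prime] (hℓ : Fintype.card F < ℓ) (lam : Fˣ)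
    (j r : ℕ) :
    ∃ G H : F[X], H.Monic ∧ G.natDegree = ℓ ^ j ∧
      G * H = (X : F[X]) ^ (ℓ ^ (j + r)) - C (lam : F) ∧
      ∀ f : F[X], Irreducible f → f ∣ H →
        ℓ ^ j ≤ ℓ ^ padicValNat ℓ (Fintype.card F ^ (ℓ - 1) - 1) * f.natDegree := by
  classical
  have hp : ℓ.Prime := Fact.out
  have hcop : (Nat.card Fˣ).Coprime (ℓ ^ (j + r)) := by
    refine Nat.Coprime.pow_right _ ((Nat.Prime.coprime_iff_not_dvd hp).2 fun h => ?_).symm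
    have h1 := Nat.le_of_dvd Nat.card_pos h
    rw [Nat.card_eq_fintype_card, Fintype.card_units] at h1
    omega
  obtain ⟨μ, hμ⟩ := (powCoprime hcop).surjective lam
  rw [powCoprime_apply] at hμ
  have hprod := geom_sum₂_mul ((X : F[X]) ^ (ℓ ^ j)) (C (μ : F) ^ (ℓ ^ j)) (ℓ ^ r)
  rw [← pow_mul, ← pow_mul, ← pow_add, ← C_pow (n := ℓ ^ (j + r)), ← Units.val_pow_eq_pow_val, hμ,
    mul_comm] at hprod
  have hG : (X ^ (ℓ ^ j) - C (μ : F) ^ (ℓ ^ j) : F[X]).Monic := by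
    rw [← C_pow]
    exact monic_X_pow_sub_C _ (pow_ne_zero _ hp.ne_zero)
  refine ⟨_, _, hG.of_mul_monic_left ?_, ?_, hprod,
    fun f hf hdvd => pow_le_natDegree_of_irreducible hℓ μ hf hdvd⟩
  · rw [hprod]
    exact monic_X_pow_sub_C _ (pow_ne_zero _ hp.ne_zero)
  · rw [← C_pow, natDegree_X_pow_sub_C]

theorem exists_two_pow_mul_rpow_lt_one {q : ℕ} (hq : 1 < q) {ε : ℝ} (hε : 0 < ε) (A : ℕ)
    (hA : 0 < A) :
    ∃ N : ℕ, ∀ t : ℕ, N ≤ t → 0 < t →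
      (2 : ℝ) ^ (A * t) * ((t : ℝ) ^ 3 * (q : ℝ) ^ (-(ε * ((t : ℝ) ^ 2 / A)))) < 1 := by
  have hq1 : (1 : ℝ) < q := by exact_mod_cast hq
  have hlq : 0 < Real.log q := Real.log_pos hq1
  have hA' : (0 : ℝ) < A := by exact_mod_cast hA
  set κ := ε * Real.log q / A with hκ
  have hκ0 : 0 < κ := by positivity
  obtain ⟨N, hN⟩ := exists_nat_gt ((A * Real.log 2 + 3) / κ)
  refine ⟨N, fun t ht ht0 => ?_⟩
  have ht0' : (0 : ℝ) < t := by exact_mod_cast ht0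
  have h1 : A * Real.log 2 + 3 < κ * t := by
    rw [div_lt_iff₀ hκ0] at hN
    have : (N : ℝ) ≤ t := by exact_mod_cast ht
    nlinarith
  have hqpos : 0 < (q : ℝ) ^ (-(ε * ((t : ℝ) ^ 2 / A))) := Real.rpow_pos_of_pos (by linarith) _
  rw [← Real.log_neg_iff (by positivity), Real.log_mul (by positivity) (by positivity),
    Real.log_mul (by positivity) hqpos.ne', Real.log_pow, Real.log_pow,
    Real.log_rpow (by linarith)]
  have h2 : Real.log t ≤ t := (Real.log_le_sub_one_of_pos ht0').trans (by linarith)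
  have h3 : -(ε * ((t : ℝ) ^ 2 / A)) * Real.log q = -(κ * t * t) := by
    rw [hκ]
    field_simp
  rw [h3]
  push_cast
  nlinarith [mul_lt_mul_of_pos_right h1 ht0']

end Factorization

/-- Let `F` be a finite field with `|F| = q` and `λ ∈ F^×`.  For every real
`δ ∈ (0, 1 − 1/q)` with `h_q(δ) < 1/2`, there exist positive integers `m₁, m₂, …` tending to
infinity and quasi-constacyclic codes `Cᵢ` of index 2 and co-index `mᵢ` over `F`
(`F[X]`-submodules of `(F[X]/⟨X^{mᵢ} − λ⟩)²`) such that `Δ(Cᵢ) > δ` for all `i` and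
`lim R(Cᵢ) = 1/2`.  In particular, quasi-constacyclic codes of index 2 over any finite field
are asymptotically good. -/
theorem stmt2 {F : Type*} [Field F] [Fintype F]
    (q : ℕ) (hq : q = Fintype.card F) (lam : Fˣ)
    (δ : ℝ) (hδ0 : 0 < δ) (hδ1 : δ < 1 - 1 / (q : ℝ))
    (hent : entropy q δ < 1 / 2) :
    ∃ (ms : ℕ → ℕ)
      (Cs : (i : ℕ) → Submodule (Polynomial F)
        (QA F (ms i) (lam : F) × QA F (ms i) (lam : F))),
      (∀ i, 0 < ms i) ∧
      Filter.Tendsto ms Filter.atTop Filter.atTop ∧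
      (∀ i, ∀ c ∈ Cs i, c ≠ 0 →
        δ * (2 * (ms i : ℝ)) <
          (qwt ((X : Polynomial F) ^ (ms i) - C (lam : F)) c.1 +
           qwt ((X : Polynomial F) ^ (ms i) - C (lam : F)) c.2 : ℝ)) ∧
      Filter.Tendsto
        (fun i => (Module.finrank F (Cs i) : ℝ) / (2 * (ms i : ℝ)))
        Filter.atTop (nhds (1 / 2)) := by
  classical
  subst hq
  set q := Fintype.card F with hq
  have hq1 : 1 < q := Fintype.one_lt_card
  obtain ⟨ℓ, hℓq, hp⟩ := Nat.exists_infinite_primes (q + 1)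
  have : Fact ℓ.Prime := ⟨hp⟩
  set A := ℓ ^ padicValNat ℓ (q ^ (ℓ - 1) - 1) with hA
  have hA0 : 0 < A := pow_pos hp.pos _
  have hε : 0 < 1 - 2 * entropy q δ := by linarith
  obtain ⟨N, hN⟩ := exists_two_pow_mul_rpow_lt_one hq1 hε A hA0
  have hcode : ∀ i : ℕ, N ≤ i →
      ∃ Cd : Submodule F[X] (QA F (ℓ ^ (2 * i + i)) (lam : F) × QA F (ℓ ^ (2 * i + i)) (lam : F)),
        (∀ c ∈ Cd, c ≠ 0 → ¬ IsLight δ c.1 c.2) ∧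
        ℓ ^ (2 * i) + Module.finrank F Cd = ℓ ^ (2 * i + i) := by
    intro i hi
    obtain ⟨G, H, hH, hGdeg, hGH, hfac⟩ := exists_factorization (F := F) hℓq lam (2 * i) i
    have hm : 0 < ℓ ^ (2 * i + i) := pow_pos hp.pos _
    set t := ℓ ^ i with ht
    have ht0 : 0 < t := pow_pos hp.pos _
    have htt : ℓ ^ (2 * i) = t ^ 2 := by rw [ht, ← pow_mul, mul_comm]
    have hmt : ℓ ^ (2 * i + i) = t ^ 3 := by rw [pow_add, htt]; ring
    have hHdeg : H.natDegree ≤ t ^ 3 := by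
      have := natDegree_le_of_dvd (Dvd.intro_left G hGH) (monic_X_pow_sub_C_unit hm).ne_zero
      rwa [natDegree_X_pow_sub_C, hmt] at this
    have hcard : Multiset.card (UniqueFactorizationMonoid.normalizedFactors H) ≤ A * t := by
      have h1 := (card_normalizedFactors_mul_le hH hfac).trans (Nat.mul_le_mul_left _ hHdeg)
      rw [htt] at h1
      refine Nat.le_of_mul_le_mul_right (h1.trans_eq ?_) (pow_pos ht0 2)
      ring
    have hE : ∀ h : F[X], h.Monic → h ∣ H → h ≠ 1 → (t : ℝ) ^ 2 / A ≤ h.natDegree := by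
      intro h hh hdvd h1
      obtain ⟨f, hf, hfh⟩ := WfDvdMonoid.exists_irreducible_factor
        (fun hu => h1 (hh.eq_one_of_isUnit hu)) hh.ne_zero
      have h2 := (hfac f hf (hfh.trans hdvd)).trans
        (Nat.mul_le_mul_left _ (natDegree_le_of_dvd hfh hh.ne_zero))
      rw [htt] at h2
      rw [div_le_iff₀' (by exact_mod_cast hA0)]
      exact_mod_cast h2
    have hlt := hN t (hi.trans (Nat.lt_pow_self hp.one_lt).le) ht0
    obtain ⟨Cd, h1, h2⟩ := exists_code hm hδ0 hδ1 hent hH hGH hE (by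
      refine lt_of_le_of_lt ?_ hlt
      rw [hmt]
      push_cast
      gcongr
      norm_num)
    exact ⟨Cd, h1, hGdeg ▸ h2⟩
  choose Cd hlight hrank using fun i : ℕ => hcode (i + N) (Nat.le_add_left N i)
  refine ⟨fun i => ℓ ^ (2 * (i + N) + (i + N)), Cd, fun i => pow_pos hp.pos _, ?_, ?_, ?_⟩
  · refine Filter.tendsto_atTop_mono (fun i => ?_) Filter.tendsto_id
    have : 2 * (i + N) + (i + N) < ℓ ^ (2 * (i + N) + (i + N)) := Nat.lt_pow_self hp.one_lt
    simp only [id]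
    omega
  · exact fun i c hc hc0 => not_le.1 (hlight i c hc hc0)
  · have hℓ0 : (ℓ : ℝ) ≠ 0 := by exact_mod_cast hp.ne_zero
    have hrate : ∀ i,
        (Module.finrank F (Cd i) : ℝ) / (2 * ((ℓ ^ (2 * (i + N) + (i + N)) : ℕ) : ℝ)) =
          1 / 2 - (1 / 2) * ((ℓ : ℝ)⁻¹) ^ (i + N) := by
      intro i
      have h1 : ((ℓ ^ (2 * (i + N)) : ℕ) : ℝ) + Module.finrank F (Cd i) =
          ((ℓ ^ (2 * (i + N) + (i + N)) : ℕ) : ℝ) := by exact_mod_cast hrank i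
      rw [eq_sub_of_add_eq' h1]
      push_cast
      rw [pow_add, inv_pow]
      field_simp
    simp only [hrate]
    have hlim : Filter.Tendsto (fun i : ℕ => ((ℓ : ℝ)⁻¹) ^ (i + N)) Filter.atTop (nhds 0) :=
      (Filter.tendsto_add_atTop_iff_nat N).2 (tendsto_pow_atTop_nhds_zero_of_lt_one (by positivity)
        (inv_lt_one_of_one_lt₀ (by exact_mod_cast hp.one_lt)))
    have h := (hlim.const_mul (1 / 2 : ℝ)).const_sub (1 / 2 : ℝ)
    rwa [mul_zero, sub_zero] at h
end

section
/- (1) For every pair (a', a) ∈ 𝓘_{λ,α'} × 𝓘_{λ,α}, the F[X]-submodule C_{a',a} generated by (a', a) satisfies dim_F C_{a',a} ≤ n − 1; equivalently R(C_{a',a}) ≤ 1/(α'+α) − 1/((α'+α)n). (2) If moreover μ(n) > log_q n, then the number of pairs (a', a) ∈ 𝓘_{λ,α'} × 𝓘_{λ,α} with dim_F C_{a',a} = n − 1 is at least (1/4)^{1/μ(n)} · q^{2(n−1)}; that is, Pr(dim_F C_{a',a} = n − 1) ≥ (1/4)^{1/μ(n)} for a uniform random pair. -/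
open Polynomial

/-- `ψ_{λ,α}(X) = Σ_{j=0}^{α−1} X^{n(α−1−j)}·(λ^{1/α})^j`, where `lam1a = λ^{1/α}`. -/
noncomputable def psiP (F : Type*) [Field F] (lam1a : F) (n a : ℕ) : Polynomial F :=
  ∑ j ∈ Finset.range a, (X : Polynomial F) ^ (n * (a - 1 - j)) * C (lam1a ^ j)

/-- `ψ⁺_{λ,α}(X) = ((X/λ^{1/(αn)}) − 1)·ψ_{λ,α}(X)`, where `μ = λ^{1/(αn)}`. -/
noncomputable def psiPlusP (F : Type*) [Field F] (μ lam1a : F) (n a : ℕ) : Polynomial F :=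
  (C μ⁻¹ * X - 1) * psiP F lam1a n a

/-- The ideal `𝓘_{λ,α} = 𝓡_{λ,α}·ψ⁺_{λ,α}(X)` of `𝓡_{λ,α} = F[X]/⟨X^{αn} − λ⟩`,
where `μ = λ^{1/(αn)}` (so `λ^{1/α} = μ^n`). -/
noncomputable def Jtw (F : Type*) [Field F] (lam μ : F) (n a : ℕ) : Ideal (QA F (a * n) lam) :=
  Ideal.span {Ideal.Quotient.mk (Ideal.span {(X : Polynomial F) ^ (a * n) - C lam})
    (psiPlusP F μ (μ ^ n) n a)}

/-- `μ(n)`: the minimum degree of a monic irreducible divisor of `X^n − 1` other than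
`X − 1`. -/
noncomputable def mun (F : Type*) [Field F] (n : ℕ) : ℕ :=
  sInf {d : ℕ | ∃ g : Polynomial F, g.Monic ∧ Irreducible g ∧
    g ∣ ((X : Polynomial F) ^ n - 1) ∧ g ≠ X - 1 ∧ g.natDegree = d}

section PolynomialFactors

variable {F : Type*} [Field F]

theorem dvd_of_dvd_mul_of_no_common_factor {h u v f : F[X]} (hh : h ≠ 0)
    (huv : ∀ φ : F[X], Irreducible φ → φ ∣ h → φ ∣ u → ¬ φ ∣ v)
    (hu : h ∣ f * u) (hv : h ∣ f * v) : h ∣ f := by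
  classical
  have hcop : IsCoprime h (EuclideanDomain.gcd u v) :=
    isCoprime_of_irreducible_dvd (fun h0 => hh h0.1) fun φ hφ hφh hφg =>
      huv φ hφ hφh (hφg.trans (EuclideanDomain.gcd_dvd_left u v))
        (hφg.trans (EuclideanDomain.gcd_dvd_right u v))
  refine hcop.dvd_of_dvd_mul_right ?_
  rw [EuclideanDomain.gcd_eq_gcd_ab u v, mul_add, ← mul_assoc, ← mul_assoc]
  exact dvd_add (hu.mul_right _) (hv.mul_right _)

theorem mul_card_factors_le_natDegree {h : F[X]} (hh : h ≠ 0) {d : ℕ}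
    (hd : ∀ φ : F[X], Irreducible φ → φ ∣ h → d ≤ φ.natDegree) :
    d * (UniqueFactorizationMonoid.factors h).card ≤ h.natDegree := by
  classical
  set s := UniqueFactorizationMonoid.factors h
  have hs0 : (0 : F[X]) ∉ s := fun h0 =>
    (UniqueFactorizationMonoid.irreducible_of_factor 0 h0).ne_zero rfl
  have hdeg : s.prod.natDegree = h.natDegree :=
    natDegree_eq_of_degree_eq
      (degree_eq_degree_of_associated (UniqueFactorizationMonoid.factors_prod hh))
  rw [← hdeg, natDegree_multiset_prod s hs0]
  have := Multiset.card_nsmul_le_sum (s := s.map natDegree) (a := d) (by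
    intro x hx
    obtain ⟨φ, hφ, rfl⟩ := Multiset.mem_map.1 hx
    exact hd φ (UniqueFactorizationMonoid.irreducible_of_factor φ hφ)
      (UniqueFactorizationMonoid.dvd_of_mem_factors hφ))
  rw [Multiset.card_map, smul_eq_mul, mul_comm] at this
  exact this

theorem eq_of_dvd_sub_of_mem_degreeLT {φ u v : F[X]} {d : ℕ} (hφ : φ ≠ 0)
    (hd : d ≤ φ.natDegree) (hu : u ∈ degreeLT F d) (hv : v ∈ degreeLT F d)
    (h : φ ∣ u - v) : u = v := by
  refine sub_eq_zero.1 (eq_zero_of_dvd_of_degree_lt h ?_)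
  rw [degree_eq_natDegree hφ]
  exact (mem_degreeLT.1 ((degreeLT F d).sub_mem hu hv)).trans_le (by exact_mod_cast hd)

end PolynomialFactors

section CyclicModule

variable {F : Type*} [Field F] {M : Type*} [AddCommGroup M] [Module F[X] M] [Module F M]
  [IsScalarTower F F[X] M]

theorem finrank_span_singleton_eq_natDegree {x : M} {g : F[X]}
    (hg : ∀ f : F[X], f • x = 0 ↔ g ∣ f) :
    Module.finrank F (Submodule.span F[X] {x}) = g.natDegree := by
  have htors : Ideal.torsionOf F[X] M x = Ideal.span {g} := by
    ext f
    rw [Ideal.mem_torsionOf_iff, Ideal.mem_span_singleton, hg]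
  rw [← finrank_quotient_span_eq_natDegree, ← htors]
  exact (((Ideal.quotTorsionOfEquivSpanSingleton F[X] M x).restrictScalars F).finrank_eq).symm

theorem finrank_span_singleton_le_natDegree {x : M} {h : F[X]} (hh : h ≠ 0)
    (hx : h • x = 0) : Module.finrank F (Submodule.span F[X] {x}) ≤ h.natDegree := by
  obtain ⟨g, hg⟩ := (IsPrincipalIdealRing.principal (Ideal.torsionOf F[X] M x)).principal
  have hmem : ∀ f : F[X], f • x = 0 ↔ g ∣ f := fun f => by
    rw [← Ideal.mem_torsionOf_iff, hg]
    exact Ideal.mem_span_singleton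
  rw [finrank_span_singleton_eq_natDegree hmem]
  exact natDegree_le_of_dvd ((hmem h).1 hx) hh

end CyclicModule

section Counting

variable {F : Type*} [Field F] [Fintype F]

instance finite_degreeLT (N : ℕ) : Finite (degreeLT F N) :=
  Finite.of_equiv _ (degreeLTEquiv F N).toEquiv.symm

theorem card_degreeLT (N : ℕ) : Nat.card (degreeLT F N) = Fintype.card F ^ N := by
  rw [Nat.card_congr (degreeLTEquiv F N).toEquiv]
  simp

theorem pow_mul_card_multiples_le {φ : F[X]} (hφ : φ ≠ 0) {d N : ℕ} (hd : d ≤ φ.natDegree)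
    (hdN : d ≤ N) :
    Fintype.card F ^ d * Nat.card {u : degreeLT F N // φ ∣ (u : F[X])} ≤
      Fintype.card F ^ N := by
  rw [← card_degreeLT, ← card_degreeLT, ← Nat.card_prod]
  refine Nat.card_le_card_of_injective
    (fun p : degreeLT F d × {u : degreeLT F N // φ ∣ (u : F[X])} =>
      (⟨p.1 + p.2.1, (degreeLT F N).add_mem (degreeLT_mono hdN p.1.2) p.2.1.2⟩ :
        degreeLT F N)) ?_
  rintro ⟨r, u, hu⟩ ⟨s, v, hv⟩ huv
  have heq : (r : F[X]) + u = s + v := congrArg Subtype.val huv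
  have hrs : (r : F[X]) = s := by
    refine eq_of_dvd_sub_of_mem_degreeLT hφ hd r.2 s.2 ?_
    rw [show (r : F[X]) - s = v - u by linear_combination heq]
    exact dvd_sub hv hu
  have huv' : (u : F[X]) = v := by rw [hrs] at heq; exact add_left_cancel heq
  simp only [Prod.mk.injEq, Subtype.mk.injEq]
  exact ⟨Subtype.ext hrs, Subtype.ext huv'⟩

theorem le_card_pairs_with_no_common_factor {h : F[X]} (hh : h ≠ 0) {d : ℕ}
    (hd : ∀ φ : F[X], Irreducible φ → φ ∣ h → d ≤ φ.natDegree) :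
    Fintype.card F ^ (2 * d) * d * Fintype.card F ^ (2 * h.natDegree) ≤
      Fintype.card F ^ (2 * d) * d *
        Nat.card {p : degreeLT F h.natDegree × degreeLT F h.natDegree //
          ∀ φ : F[X], Irreducible φ → φ ∣ h → φ ∣ (p.1 : F[X]) → ¬ φ ∣ (p.2 : F[X])} +
      h.natDegree * Fintype.card F ^ (2 * h.natDegree) := by
  classical
  set N := h.natDegree
  set q := Fintype.card F
  let _ : Fintype (degreeLT F N × degreeLT F N) := Fintype.ofFinite _
  set s := UniqueFactorizationMonoid.factors h
  let good : Finset (degreeLT F N × degreeLT F N) := Finset.univ.filter fun p =>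
    ∀ φ : F[X], Irreducible φ → φ ∣ h → φ ∣ (p.1 : F[X]) → ¬ φ ∣ (p.2 : F[X])
  let bad : F[X] → Finset (degreeLT F N × degreeLT F N) := fun φ =>
    Finset.univ.filter fun p => φ ∣ (p.1 : F[X]) ∧ φ ∣ (p.2 : F[X])
  have hcover : (Finset.univ : Finset (degreeLT F N × degreeLT F N)) ⊆
      good ∪ s.toFinset.biUnion bad := by
    intro p _
    rw [Finset.mem_union, or_iff_not_imp_left]
    intro hp
    simp only [good, Finset.mem_filter, Finset.mem_univ, true_and] at hp
    push Not at hp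
    obtain ⟨φ, hφ, hφh, h1, h2⟩ := hp
    obtain ⟨ψ, hψ, hass⟩ :=
      UniqueFactorizationMonoid.exists_mem_factors_of_dvd hh hφ hφh
    simp only [bad, Finset.mem_biUnion, Multiset.mem_toFinset, Finset.mem_filter,
      Finset.mem_univ, true_and]
    exact ⟨ψ, hψ, hass.symm.dvd.trans h1, hass.symm.dvd.trans h2⟩
  have hbad : ∀ φ ∈ s.toFinset, q ^ (2 * d) * (bad φ).card ≤ q ^ (2 * N) := by
    intro φ hφ
    have hφs := Multiset.mem_toFinset.1 hφ
    have hirr := UniqueFactorizationMonoid.irreducible_of_factor φ hφs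
    have hdvd := UniqueFactorizationMonoid.dvd_of_mem_factors hφs
    have hdφ := hd φ hirr hdvd
    have hle := pow_mul_card_multiples_le hirr.ne_zero hdφ
      (hdφ.trans (natDegree_le_of_dvd hdvd hh))
    have hcard : (bad φ).card = Nat.card {u : degreeLT F N // φ ∣ (u : F[X])} *
        Nat.card {u : degreeLT F N // φ ∣ (u : F[X])} := by
      rw [← Nat.card_prod, ← Nat.card_congr Equiv.subtypeProdEquivProd,
        Nat.card_eq_fintype_card, Fintype.card_subtype]
    calc q ^ (2 * d) * (bad φ).card
        = (q ^ d * Nat.card {u : degreeLT F N // φ ∣ (u : F[X])}) *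
          (q ^ d * Nat.card {u : degreeLT F N // φ ∣ (u : F[X])}) := by rw [hcard]; ring
      _ ≤ q ^ N * q ^ N := Nat.mul_le_mul hle hle
      _ = q ^ (2 * N) := by ring
  have htotal : q ^ (2 * N) ≤ good.card + ∑ φ ∈ s.toFinset, (bad φ).card := by
    calc q ^ (2 * N) = (Finset.univ : Finset (degreeLT F N × degreeLT F N)).card := by
          rw [Finset.card_univ, ← Nat.card_eq_fintype_card, Nat.card_prod, card_degreeLT]
          ring
      _ ≤ (good ∪ s.toFinset.biUnion bad).card := Finset.card_le_card hcover
      _ ≤ good.card + (s.toFinset.biUnion bad).card := Finset.card_union_le _ _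
      _ ≤ _ := Nat.add_le_add_left Finset.card_biUnion_le _
  have hsum : q ^ (2 * d) * ∑ φ ∈ s.toFinset, (bad φ).card ≤ s.card * q ^ (2 * N) := by
    rw [Finset.mul_sum]
    refine (Finset.sum_le_card_nsmul _ _ _ hbad).trans ?_
    rw [smul_eq_mul]
    exact Nat.mul_le_mul_right _ (Multiset.toFinset_card_le s)
  have hgood : Nat.card {p : degreeLT F N × degreeLT F N //
      ∀ φ : F[X], Irreducible φ → φ ∣ h → φ ∣ (p.1 : F[X]) → ¬ φ ∣ (p.2 : F[X])} =
      good.card := by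
    rw [Nat.card_eq_fintype_card, Fintype.card_subtype]
  rw [hgood]
  calc q ^ (2 * d) * d * q ^ (2 * N)
      ≤ q ^ (2 * d) * d * (good.card + ∑ φ ∈ s.toFinset, (bad φ).card) :=
        Nat.mul_le_mul_left _ htotal
    _ = q ^ (2 * d) * d * good.card +
        d * (q ^ (2 * d) * ∑ φ ∈ s.toFinset, (bad φ).card) := by ring
    _ ≤ q ^ (2 * d) * d * good.card + d * (s.card * q ^ (2 * N)) := by gcongr
    _ = q ^ (2 * d) * d * good.card + (d * s.card) * q ^ (2 * N) := by ring
    _ ≤ _ := by gcongr; exact mul_card_factors_le_natDegree hh hd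

end Counting

section TwistedIdeals

variable {F : Type*} [Field F]

theorem psiP_mul_sub (c : F) (n a : ℕ) :
    psiP F c n a * (X ^ n - C c) = X ^ (a * n) - C (c ^ a) := by
  have h := geom_sum₂_mul (C c : F[X]) (X ^ n) a
  have hpsi : psiP F c n a = ∑ i ∈ Finset.range a, (C c : F[X]) ^ i * (X ^ n) ^ (a - 1 - i) := by
    refine Finset.sum_congr rfl fun j _ => ?_
    rw [C_pow, ← pow_mul, mul_comm]
  rw [hpsi, C_pow, mul_comm a n, pow_mul]
  linear_combination -h

/-- `μ · (X^n − μ^n)/(X − μ)`, the cofactor of `ψ⁺_{λ,α}` in `X^{αn} − λ`. -/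
noncomputable def checkP (μ : F) (n : ℕ) : F[X] :=
  C μ * ∑ i ∈ Finset.range n, X ^ i * C μ ^ (n - 1 - i)

theorem mul_checkP {μ : F} (hμ : μ ≠ 0) (n : ℕ) :
    (C μ⁻¹ * X - 1) * checkP μ n = X ^ n - C (μ ^ n) := by
  have hC : (C μ⁻¹ : F[X]) * C μ = 1 := by rw [← C_mul, inv_mul_cancel₀ hμ, C_1]
  have h := geom_sum₂_mul (X : F[X]) (C μ) n
  rw [checkP, C_pow, ← h]
  linear_combination (∑ i ∈ Finset.range n, X ^ i * C μ ^ (n - 1 - i)) * X * hC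

theorem psiPlusP_mul_checkP {μ : F} (hμ : μ ≠ 0) (n a : ℕ) :
    psiPlusP F μ (μ ^ n) n a * checkP μ n = X ^ (a * n) - C (μ ^ (a * n)) := by
  rw [mul_comm a n, pow_mul μ, mul_comm n a, ← psiP_mul_sub, psiPlusP, ← mul_checkP hμ]
  ring

theorem checkP_ne_zero {μ : F} (hμ : μ ≠ 0) {n : ℕ} (hn : 0 < n) : checkP μ n ≠ 0 := by
  intro h
  have := mul_checkP hμ n
  rw [h, mul_zero] at this
  exact X_pow_sub_C_ne_zero hn _ this.symm

theorem natDegree_checkP {μ : F} (hμ : μ ≠ 0) {n : ℕ} (hn : 0 < n) :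
    (checkP μ n).natDegree = n - 1 := by
  have hlin : (C μ⁻¹ * X - 1 : F[X]) = C μ⁻¹ * X + C (-1) := by rw [C_neg, C_1, sub_eq_add_neg]
  have hdeg : (C μ⁻¹ * X - 1 : F[X]).natDegree = 1 := by
    rw [hlin]; exact natDegree_linear (inv_ne_zero hμ)
  have h := congrArg natDegree (mul_checkP hμ n)
  rw [natDegree_mul (ne_zero_of_natDegree_gt (n := 0) (by omega)) (checkP_ne_zero hμ hn),
    hdeg, natDegree_X_pow_sub_C] at h
  omega

theorem eval_checkP (μ : F) {n : ℕ} (hn : 0 < n) : (checkP μ n).eval μ = n * μ ^ n := by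
  rw [checkP, eval_mul, eval_C, eval_finsetSum]
  rw [Finset.sum_congr rfl (g := fun _ => μ ^ (n - 1)) fun i hi => ?_]
  · rw [Finset.sum_const, Finset.card_range, nsmul_eq_mul, mul_left_comm, ← pow_succ',
      Nat.sub_add_cancel hn]
  · rw [Finset.mem_range] at hi
    rw [eval_mul, eval_pow, eval_pow, eval_X, eval_C, ← pow_add]
    congr 1
    omega

theorem exists_mulEquiv_comp_C_mul_X {μ : F} (hμ : μ ≠ 0) :
    ∃ e : F[X] ≃* F[X], ∀ p : F[X], e p = p.comp (C μ * X) := by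
  let _ : Invertible μ := invertibleOfNonzero hμ
  exact ⟨(algEquivCMulXAddC μ 0).toMulEquiv, fun p => by simp [comp, aeval_def, eval₂_eq_sum]⟩

theorem mun_le_natDegree_of_dvd_checkP {μ : F} (hμ : μ ≠ 0) {n : ℕ} (hn : (n : F) ≠ 0)
    {φ : F[X]} (hφ : Irreducible φ) (hdvd : φ ∣ checkP μ n) : mun F n ≤ φ.natDegree := by
  have hn0 : 0 < n := Nat.pos_of_ne_zero fun h => hn (by rw [h, Nat.cast_zero])
  obtain ⟨e, he_apply⟩ := exists_mulEquiv_comp_C_mul_X hμ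
  have hmap : ∀ p r : F[X], p ∣ r → e p ∣ e r := by
    rintro p _ ⟨c, rfl⟩
    exact ⟨e c, map_mul e p c⟩
  have hirr : Irreducible (e φ) := (MulEquiv.irreducible_iff e).2 hφ
  have hlead : (e φ).leadingCoeff ≠ 0 := leadingCoeff_ne_zero.2 hirr.ne_zero
  have hunit : IsUnit (C (e φ).leadingCoeff⁻¹ : F[X]) :=
    isUnit_C.2 (inv_ne_zero hlead).isUnit
  have hass : Associated (e φ) (e φ * C (e φ).leadingCoeff⁻¹) :=
    (associated_mul_unit_left _ _ hunit).symm
  refine Nat.sInf_le ⟨e φ * C (e φ).leadingCoeff⁻¹, monic_mul_leadingCoeff_inv hirr.ne_zero,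
    hass.irreducible hirr, ?_, ?_, ?_⟩
  · have h1 : φ ∣ X ^ n - C (μ ^ n) := by
      rw [← mul_checkP hμ n]
      exact hdvd.mul_left _
    have h2 : e (X ^ n - C (μ ^ n)) = C (μ ^ n) * (X ^ n - 1) := by
      rw [he_apply, sub_comp, X_pow_comp, C_comp, mul_pow, ← C_pow, mul_sub, mul_one]
    have h3 : e φ ∣ C (μ ^ n) * (X ^ n - 1) := by
      rw [← h2]
      exact hmap _ _ h1
    have hu : IsUnit (C (μ ^ n) : F[X]) := isUnit_C.2 (pow_ne_zero n hμ).isUnit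
    exact hass.symm.dvd.trans (hu.dvd_mul_left.1 h3)
  · intro heq
    have h1 : (X - C 1 : F[X]) ∣ e (checkP μ n) := by
      rw [C_1, ← heq]
      exact hass.symm.dvd.trans (hmap _ _ hdvd)
    rw [dvd_iff_isRoot, IsRoot, he_apply, eval_comp] at h1
    simp only [eval_mul, eval_C, eval_X, mul_one, eval_checkP μ hn0] at h1
    exact mul_ne_zero hn (pow_ne_zero n hμ) h1
  · rw [natDegree_mul_C (inv_ne_zero hlead), he_apply, natDegree_comp, natDegree_C_mul_X μ hμ,
      mul_one]

end TwistedIdeals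

section PairModule

variable {F : Type*} [Field F]

theorem smul_mk_eq_zero_iff {P Q h : F[X]} (hQ : Q ≠ 0) (hP : Q * h = P) (f u : F[X]) :
    f • (Ideal.Quotient.mk (Ideal.span {P}) (u * Q)) = 0 ↔ h ∣ f * u := by
  have hsmul : f • (Ideal.Quotient.mk (Ideal.span {P}) (u * Q)) =
      Ideal.Quotient.mk (Ideal.span {P}) (Q * (f * u)) := by
    rw [show Q * (f * u) = f * (u * Q) by ring]
    rfl
  rw [hsmul, Ideal.Quotient.eq_zero_iff_dvd, ← hP]
  exact mul_dvd_mul_iff_left hQ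

theorem smul_mk_prod_eq_zero_iff {P P' Q Q' h : F[X]} (hQ : Q ≠ 0) (hQ' : Q' ≠ 0)
    (hP : Q * h = P) (hP' : Q' * h = P') (f u v : F[X]) :
    f • (Ideal.Quotient.mk (Ideal.span {P}) (u * Q),
      Ideal.Quotient.mk (Ideal.span {P'}) (v * Q')) = 0 ↔ h ∣ f * u ∧ h ∣ f * v := by
  rw [Prod.smul_mk, Prod.mk_eq_zero, smul_mk_eq_zero_iff hQ hP, smul_mk_eq_zero_iff hQ' hP']

theorem exists_mk_mul_of_mem_span {P Q : F[X]} {a : F[X] ⧸ Ideal.span {P}}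
    (ha : a ∈ Ideal.span {Ideal.Quotient.mk (Ideal.span {P}) Q}) :
    ∃ u : F[X], Ideal.Quotient.mk (Ideal.span {P}) (u * Q) = a := by
  obtain ⟨c, rfl⟩ := Ideal.mem_span_singleton'.1 ha
  obtain ⟨u, rfl⟩ := Ideal.Quotient.mk_surjective c
  exact ⟨u, map_mul _ _ _⟩

theorem mk_mul_mem_span (P Q u : F[X]) : Ideal.Quotient.mk (Ideal.span {P}) (u * Q) ∈
    Ideal.span {Ideal.Quotient.mk (Ideal.span {P}) Q} :=
  Ideal.mem_span_singleton'.2 ⟨Ideal.Quotient.mk _ u, (map_mul _ _ _).symm⟩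

theorem mk_mul_injOn_degreeLT {P Q h : F[X]} (hQ : Q ≠ 0) (hh : h ≠ 0) (hP : Q * h = P) :
    Set.InjOn (fun u : F[X] => Ideal.Quotient.mk (Ideal.span {P}) (u * Q))
      (degreeLT F h.natDegree) := by
  intro u hu v hv huv
  refine eq_of_dvd_sub_of_mem_degreeLT hh le_rfl hu hv ?_
  rw [← one_mul (u - v), ← smul_mk_eq_zero_iff hQ hP, one_smul, sub_mul, map_sub]
  exact sub_eq_zero.2 huv

theorem finrank_span_pair_le {P P' Q Q' h : F[X]} (hQ : Q ≠ 0) (hQ' : Q' ≠ 0) (hh : h ≠ 0)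
    (hP : Q * h = P) (hP' : Q' * h = P')
    {a : F[X] ⧸ Ideal.span {P}} {a' : F[X] ⧸ Ideal.span {P'}}
    (ha : a ∈ Ideal.span {Ideal.Quotient.mk (Ideal.span {P}) Q})
    (ha' : a' ∈ Ideal.span {Ideal.Quotient.mk (Ideal.span {P'}) Q'}) :
    Module.finrank F (Submodule.span F[X] {(a, a')}) ≤ h.natDegree := by
  obtain ⟨u, rfl⟩ := exists_mk_mul_of_mem_span ha
  obtain ⟨v, rfl⟩ := exists_mk_mul_of_mem_span ha'
  exact finrank_span_singleton_le_natDegree hh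
    ((smul_mk_prod_eq_zero_iff hQ hQ' hP hP' h u v).2 ⟨dvd_mul_right _ _, dvd_mul_right _ _⟩)

theorem finrank_span_pair_eq {P P' Q Q' h u v : F[X]} (hQ : Q ≠ 0) (hQ' : Q' ≠ 0)
    (hh : h ≠ 0) (hP : Q * h = P) (hP' : Q' * h = P')
    (huv : ∀ φ : F[X], Irreducible φ → φ ∣ h → φ ∣ u → ¬ φ ∣ v) :
    Module.finrank F (Submodule.span F[X] {(Ideal.Quotient.mk (Ideal.span {P}) (u * Q),
      Ideal.Quotient.mk (Ideal.span {P'}) (v * Q'))}) = h.natDegree := by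
  refine finrank_span_singleton_eq_natDegree fun f => ?_
  rw [smul_mk_prod_eq_zero_iff hQ hQ' hP hP']
  exact ⟨fun hf => dvd_of_dvd_mul_of_no_common_factor hh huv hf.1 hf.2,
    fun hf => ⟨hf.mul_right _, hf.mul_right _⟩⟩

theorem finite_quotient_span_singleton [Finite F] {P : F[X]} (hP : P ≠ 0) :
    Finite (F[X] ⧸ Ideal.span {P}) := by
  have : Module.Finite F (F[X] ⧸ Ideal.span {P}) := by
    have hmonic := (monic_mul_leadingCoeff_inv hP).finite_quotient
    rwa [Ideal.span_singleton_mul_right_unit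
      (isUnit_C.2 (inv_ne_zero (leadingCoeff_ne_zero.2 hP)).isUnit)] at hmonic
  exact Module.finite_of_finite F

theorem card_pairs_with_no_common_factor_le [Finite F] {P P' Q Q' h : F[X]} (hQ : Q ≠ 0)
    (hQ' : Q' ≠ 0) (hh : h ≠ 0) (hP : Q * h = P) (hP' : Q' * h = P')
    {I : Ideal (F[X] ⧸ Ideal.span {P})} {I' : Ideal (F[X] ⧸ Ideal.span {P'})}
    (hI : I = Ideal.span {Ideal.Quotient.mk (Ideal.span {P}) Q})
    (hI' : I' = Ideal.span {Ideal.Quotient.mk (Ideal.span {P'}) Q'}) :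
    Nat.card {p : degreeLT F h.natDegree × degreeLT F h.natDegree //
      ∀ φ : F[X], Irreducible φ → φ ∣ h → φ ∣ (p.1 : F[X]) → ¬ φ ∣ (p.2 : F[X])} ≤
    Nat.card {p : I × I' // Module.finrank F (Submodule.span F[X]
      {((p.1 : F[X] ⧸ Ideal.span {P}), (p.2 : F[X] ⧸ Ideal.span {P'}))}) = h.natDegree} := by
  subst hI hI'
  have := finite_quotient_span_singleton (hP ▸ mul_ne_zero hQ hh : P ≠ 0)
  have := finite_quotient_span_singleton (hP' ▸ mul_ne_zero hQ' hh : P' ≠ 0)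
  refine Nat.card_le_card_of_injective (fun p =>
    ⟨(⟨_, mk_mul_mem_span P Q p.1.1⟩, ⟨_, mk_mul_mem_span P' Q' p.1.2⟩),
      finrank_span_pair_eq hQ hQ' hh hP hP' p.2⟩) ?_
  rintro ⟨⟨u, v⟩, _⟩ ⟨⟨u', v'⟩, _⟩ heq
  simp only [Subtype.mk.injEq, Prod.mk.injEq] at heq
  exact Subtype.ext (Prod.ext
    (Subtype.ext (mk_mul_injOn_degreeLT hQ hh hP u.2 u'.2 heq.1))
    (Subtype.ext (mk_mul_injOn_degreeLT hQ' hh hP' v.2 v'.2 heq.2)))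

end PairModule

theorem quarter_rpow_le {n d : ℕ} (hd : 0 < d) {Q : ℝ} (hn : 0 < n) (hQ : (n : ℝ) ≤ Q) :
    (1 / 4 : ℝ) ^ ((1 : ℝ) / d) ≤ 1 - ((n - 1 : ℕ) : ℝ) / (Q ^ 2 * d) := by
  have hd' : (1 : ℝ) ≤ d := by exact_mod_cast hd
  have hn' : (1 : ℝ) ≤ n := by exact_mod_cast hn
  have hbern := rpow_one_add_le_one_add_mul_self (s := (-3 / 4 : ℝ)) (by norm_num)
    (p := 1 / (d : ℝ)) (by positivity) ((div_le_one (by positivity)).2 hd')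
  have hfrac : ((n - 1 : ℕ) : ℝ) / Q ^ 2 ≤ 3 / 4 := by
    rw [div_le_div_iff₀ (by nlinarith) (by norm_num), Nat.cast_sub hn, Nat.cast_one]
    nlinarith [sq_nonneg ((n : ℝ) - 2)]
  have hmul := mul_le_mul_of_nonneg_left hfrac (by positivity : (0 : ℝ) ≤ 1 / d)
  have hsplit : ((n - 1 : ℕ) : ℝ) / (Q ^ 2 * d) = 1 / d * (((n - 1 : ℕ) : ℝ) / Q ^ 2) := by
    rw [div_mul_div_comm, one_mul, mul_comm (d : ℝ)]
  rw [show (1 + -3 / 4 : ℝ) = 1 / 4 by norm_num] at hbern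
  rw [hsplit]
  linarith

/-- (1) For every pair `(a', a) ∈ 𝓘_{λ,α'} × 𝓘_{λ,α}`, the
`F[X]`-submodule `C_{a',a}` generated by `(a', a)` satisfies `dim_F C_{a',a} ≤ n − 1`.
(2) If moreover `μ(n) > log_q n`, then the number of pairs
`(a', a) ∈ 𝓘_{λ,α'} × 𝓘_{λ,α}` with `dim_F C_{a',a} = n − 1` is at least
`(1/4)^{1/μ(n)} · q^{2(n−1)}`. -/
theorem stmt14 {F : Type*} [Field F] [Fintype F]
    (q : ℕ) (hq : q = Fintype.card F)
    (lam : Fˣ) (t : ℕ) (ht : t = orderOf lam)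
    (α α' n : ℕ) (hα : 0 < α) (hα' : 0 < α') (hn : 0 < n)
    (hcong : α' ≡ α [MOD t]) (hαt : Nat.gcd α t = 1) (hnqt : Nat.gcd n (q * t) = 1)
    (μ : Fˣ) (hμ : μ ∈ Subgroup.zpowers lam) (hμpow : μ ^ (α * n) = lam) :
    (∀ (a' : Jtw F (lam : F) (μ : F) n α') (a : Jtw F (lam : F) (μ : F) n α),
      Module.finrank F (Submodule.span (Polynomial F)
        {((a' : QA F (α' * n) (lam : F)), (a : QA F (α * n) (lam : F)))}) ≤ n - 1) ∧
    (Real.logb q n < (mun F n : ℝ) →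
      ((1 / 4 : ℝ) ^ ((1 : ℝ) / (mun F n : ℝ)) * (q : ℝ) ^ (2 * (n - 1)) : ℝ) ≤
        (Nat.card {p : Jtw F (lam : F) (μ : F) n α' × Jtw F (lam : F) (μ : F) n α //
          Module.finrank F (Submodule.span (Polynomial F)
            {((p.1 : QA F (α' * n) (lam : F)), (p.2 : QA F (α * n) (lam : F)))}) = n - 1} : ℝ)) := by
  have hμ0 : (μ : F) ≠ 0 := μ.ne_zero
  have hμt : μ ^ t = 1 := by
    obtain ⟨k, rfl⟩ := Subgroup.mem_zpowers_iff.1 hμ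
    rw [← zpow_natCast, ← zpow_mul, mul_comm, zpow_mul, zpow_natCast, ht, pow_orderOf_eq_one,
      one_zpow]
  have hμpow' : μ ^ (α' * n) = lam := by
    rw [← hμpow]
    exact pow_eq_pow_iff_modEq.2 ((hcong.mul_right n).of_dvd (orderOf_dvd_of_pow_eq_one hμt))
  have hfac : psiPlusP F (μ : F) ((μ : F) ^ n) n α * checkP (μ : F) n =
      X ^ (α * n) - C (lam : F) := by
    rw [psiPlusP_mul_checkP hμ0, ← hμpow, Units.val_pow_eq_pow_val]
  have hfac' : psiPlusP F (μ : F) ((μ : F) ^ n) n α' * checkP (μ : F) n =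
      X ^ (α' * n) - C (lam : F) := by
    rw [psiPlusP_mul_checkP hμ0, ← hμpow', Units.val_pow_eq_pow_val]
  have hh := checkP_ne_zero hμ0 hn
  have hQ : psiPlusP F (μ : F) ((μ : F) ^ n) n α ≠ 0 := fun h0 =>
    X_pow_sub_C_ne_zero (Nat.mul_pos hα hn) (lam : F) (by rw [← hfac, h0, zero_mul])
  have hQ' : psiPlusP F (μ : F) ((μ : F) ^ n) n α' ≠ 0 := fun h0 =>
    X_pow_sub_C_ne_zero (Nat.mul_pos hα' hn) (lam : F) (by rw [← hfac', h0, zero_mul])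
  have hdeg := natDegree_checkP hμ0 hn
  have hnF : (n : F) ≠ 0 := by
    have hcop : IsCoprime (n : F) (q : F) := (Nat.Coprime.coprime_mul_right_right hnqt).cast
    rw [hq, FiniteField.cast_card_eq_zero, isCoprime_zero_right] at hcop
    exact hcop.ne_zero
  refine ⟨fun a' a => ?_, fun hlog => ?_⟩
  · rw [← hdeg]
    exact finrank_span_pair_le hQ' hQ hh hfac' hfac a'.2 a.2
  have hq1 : 1 < q := hq ▸ Fintype.one_lt_card
  have hq1' : (1 : ℝ) < q := by exact_mod_cast hq1
  have hn1 : (1 : ℝ) ≤ n := by exact_mod_cast hn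
  have hd : 0 < mun F n := by
    exact_mod_cast (Real.logb_nonneg hq1' hn1).trans_lt hlog
  have hnq : (n : ℝ) ≤ (q : ℝ) ^ mun F n := by
    rw [Real.logb_lt_iff_lt_rpow hq1' (by linarith), Real.rpow_natCast] at hlog
    exact hlog.le
  have hcount := le_card_pairs_with_no_common_factor hh fun φ hφ hdvd =>
    mun_le_natDegree_of_dvd_checkP hμ0 hnF hφ hdvd
  have hcard := card_pairs_with_no_common_factor_le hQ' hQ hh hfac' hfac
    (I := Jtw F (lam : F) (μ : F) n α') (I' := Jtw F (lam : F) (μ : F) n α) rfl rfl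
  have hmain := hcount.trans (Nat.add_le_add_right (Nat.mul_le_mul_left _ hcard) _)
  rw [hdeg, ← hq] at hmain
  refine (mul_le_mul_of_nonneg_right (quarter_rpow_le hd hn hnq) (by positivity)).trans ?_
  generalize Nat.card _ = c at hmain ⊢
  have hmain' : ((q : ℝ) ^ mun F n) ^ 2 * mun F n * (q : ℝ) ^ (2 * (n - 1)) ≤
      ((q : ℝ) ^ mun F n) ^ 2 * mun F n * c + (n - 1 : ℕ) * (q : ℝ) ^ (2 * (n - 1)) := by
    rw [← pow_mul, mul_comm (mun F n) 2]
    exact_mod_cast hmain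
  have hpos : 0 < ((q : ℝ) ^ mun F n) ^ 2 * mun F n := by positivity
  rw [one_sub_div hpos.ne', div_mul_eq_mul_div, div_le_iff₀ hpos]
  linarith
end
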